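/- Suppose there exist symmetric positive definite matrices P̄_i ∈ ℝ^{n_x×n_x} (i = 1,…,N) such that P̄_i − A_iᵀP̄_jA_i + CᵀC is positive definite for all i, j ∈ {1,…,N}. Then the polytopic system is poly-quadratically detectable; moreover, the observer gain L(k,p) := −Σ_{i=1}^N ξ_i(p_k) A_i(P̄_i + CᵀC)⁻¹Cᵀ (for k ∈ ℕ and sequences p : ℕ → ℙ) renders the error system e_{k+1} = (A(p_k) + L(k,p)C)e_k poly-quadratically stable with poly-quadratic Lyapunov function V(π,e) = eᵀP(π)e where P(π) = Σ_{i=1}^N ξ_i(π)P̄_i. -/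

import Mathlib

open Matrix

/-- An observer gain `L(k,p)` renders the error system
`e_{k+1} = (A(p_k) + L(k,p)C)e_k` poly-quadratically stable with poly-quadratic
Lyapunov function `V(π,e) = eᵀP(π)e`, `P(π) = Σᵢ ξᵢ(π)P̄ᵢ`. -/
def RendersErrorPolyQS (nx ny np N : ℕ) (Pset : Set (Fin np → ℝ))
    (ξ : Fin N → Pset → ℝ) (A : Fin N → Matrix (Fin nx) (Fin nx) ℝ)
    (C : Matrix (Fin ny) (Fin nx) ℝ)
    (L : ℕ → (ℕ → Pset) → Matrix (Fin nx) (Fin ny) ℝ)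
    (Pb : Fin N → Matrix (Fin nx) (Fin nx) ℝ) : Prop :=
  ∃ a₁ a₂ a₃ : ℝ, 0 < a₁ ∧ 0 < a₂ ∧ 0 < a₃ ∧
    (∀ (π : Pset) (e : Fin nx → ℝ),
      a₁ * (e ⬝ᵥ e) ≤ e ⬝ᵥ ((∑ i, ξ i π • Pb i) *ᵥ e) ∧
      e ⬝ᵥ ((∑ i, ξ i π • Pb i) *ᵥ e) ≤ a₂ * (e ⬝ᵥ e)) ∧
    (∀ (p : ℕ → Pset) (k : ℕ) (e : Fin nx → ℝ),
      (((∑ i, ξ i (p k) • A i) + L k p * C) *ᵥ e) ⬝ᵥ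
          ((∑ i, ξ i (p (k + 1)) • Pb i) *ᵥ
            (((∑ i, ξ i (p k) • A i) + L k p * C) *ᵥ e))
        ≤ e ⬝ᵥ ((∑ i, ξ i (p k) • Pb i) *ᵥ e) - a₃ * (e ⬝ᵥ e))

/-- The polytopic system with output matrix `C` is poly-quadratically detectable:
some observer gain `L` renders the error system poly-quadratically stable with a
poly-quadratic Lyapunov function built from symmetric matrices `P̄ᵢ`. -/
def PolyQDetectable (nx ny np N : ℕ) (Pset : Set (Fin np → ℝ))
    (ξ : Fin N → Pset → ℝ) (A : Fin N → Matrix (Fin nx) (Fin nx) ℝ)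
    (C : Matrix (Fin ny) (Fin nx) ℝ) : Prop :=
  ∃ (L : ℕ → (ℕ → Pset) → Matrix (Fin nx) (Fin ny) ℝ)
    (Pb : Fin N → Matrix (Fin nx) (Fin nx) ℝ),
    (∀ i, (Pb i).IsSymm) ∧ RendersErrorPolyQS nx ny np N Pset ξ A C L Pb

/-- A positive definite quadratic form dominates a positive multiple of the squared norm. -/
lemma Matrix.PosDef.exists_pos_mul_dotProduct_le {n : Type*} [Fintype n] {M : Matrix n n ℝ}
    (hM : M.PosDef) : ∃ c : ℝ, 0 < c ∧ ∀ e : n → ℝ, c * (e ⬝ᵥ e) ≤ e ⬝ᵥ (M *ᵥ e) := by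
  have hcompact : IsCompact {e : n → ℝ | e ⬝ᵥ e = 1} := by
    refine Metric.isCompact_of_isClosed_isBounded
      (isClosed_eq (by fun_prop) continuous_const) ?_
    refine (Metric.isBounded_closedBall (x := (0 : n → ℝ)) (r := 1)).subset fun e he => ?_
    rw [mem_closedBall_zero_iff, pi_norm_le_iff_of_nonneg zero_le_one]
    intro i
    have h : e i * e i ≤ e ⬝ᵥ e :=
      Finset.single_le_sum (f := fun i => e i * e i) (fun j _ => mul_self_nonneg _)
        (Finset.mem_univ i)
    rw [he.out] at h
    exact abs_le_one_iff_mul_self_le_one.2 h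
  obtain ⟨c, hc, hle⟩ := hcompact.exists_forall_le' (f := fun e => e ⬝ᵥ (M *ᵥ e)) (a := 0)
    (by fun_prop) (fun e he => by
      have he0 : e ≠ 0 := by
        rintro rfl
        simp at he
      simpa using hM.dotProduct_mulVec_pos he0)
  refine ⟨c, hc, fun e => ?_⟩
  rcases eq_or_ne e 0 with rfl | he
  · simp
  have hpos : 0 < e ⬝ᵥ e := by simpa using dotProduct_star_self_pos_iff.2 he
  set s := Real.sqrt (e ⬝ᵥ e)
  have hs : s * s = e ⬝ᵥ e := Real.mul_self_sqrt hpos.le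
  have hs0 : s ≠ 0 := (Real.sqrt_pos.2 hpos).ne'
  have h := hle (s⁻¹ • e) (by
    simp only [Set.mem_ofPred_eq, smul_dotProduct, dotProduct_smul, smul_eq_mul, ← hs]
    field_simp)
  simp only [mulVec_smul, smul_dotProduct, dotProduct_smul, smul_eq_mul] at h
  calc c * (e ⬝ᵥ e) ≤ s⁻¹ * (s⁻¹ * e ⬝ᵥ (M *ᵥ e)) * (e ⬝ᵥ e) :=
        mul_le_mul_of_nonneg_right h hpos.le
    _ = e ⬝ᵥ (M *ᵥ e) := by
        rw [← hs]
        field_simp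

/-- A quadratic form is dominated by a positive multiple of the squared norm. -/
lemma Matrix.exists_dotProduct_mulVec_le {n : Type*} [Fintype n] (M : Matrix n n ℝ) :
    ∃ c : ℝ, 0 < c ∧ ∀ e : n → ℝ, e ⬝ᵥ (M *ᵥ e) ≤ c * (e ⬝ᵥ e) := by
  refine ⟨∑ i, ∑ j, |M i j| + 1, by positivity, fun e => ?_⟩
  have hsq : ∀ i, e i ^ 2 ≤ e ⬝ᵥ e := fun i => by
    rw [sq]
    exact Finset.single_le_sum (f := fun i => e i * e i) (fun j _ => mul_self_nonneg _)
      (Finset.mem_univ i)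
  have hnonneg : 0 ≤ e ⬝ᵥ e := Finset.sum_nonneg fun i _ => mul_self_nonneg _
  have h : e ⬝ᵥ (M *ᵥ e) ≤ (∑ i, ∑ j, |M i j|) * (e ⬝ᵥ e) := by
    simp only [Finset.sum_mul]
    have hexp : e ⬝ᵥ (M *ᵥ e) = ∑ i, ∑ j, e i * (M i j * e j) := by
      simp only [dotProduct, mulVec, Finset.mul_sum]
    rw [hexp]
    refine Finset.sum_le_sum fun i _ => Finset.sum_le_sum fun j _ => ?_
    have hij : |e i * e j| ≤ e ⬝ᵥ e := by
      rw [abs_le]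
      constructor <;> nlinarith [hsq i, hsq j, sq_nonneg (e i + e j), sq_nonneg (e i - e j)]
    calc e i * (M i j * e j) = M i j * (e i * e j) := by ring
      _ ≤ |M i j| * |e i * e j| := by rw [← abs_mul]; exact le_abs_self _
      _ ≤ |M i j| * (e ⬝ᵥ e) := by gcongr
  linarith

/-- A common quadratic lower bound for a finite family of positive definite matrices. -/
lemma Matrix.exists_pos_forall_mul_dotProduct_le {ι n : Type*} [Finite ι] [Fintype n]
    {M : ι → Matrix n n ℝ} (hM : ∀ i, (M i).PosDef) :
    ∃ c : ℝ, 0 < c ∧ ∀ i (e : n → ℝ), c * (e ⬝ᵥ e) ≤ e ⬝ᵥ (M i *ᵥ e) := by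
  cases nonempty_fintype ι
  choose c hc h using fun i => (hM i).exists_pos_mul_dotProduct_le
  obtain ⟨b, hb, hbc⟩ : ∃ b, 0 < b ∧ ∀ i, b ≤ c i := by
    cases isEmpty_or_nonempty ι
    · exact ⟨1, one_pos, isEmptyElim⟩
    · obtain ⟨i, hi⟩ := Finite.exists_min c
      exact ⟨c i, hc i, hi⟩
  exact ⟨b, hb, fun i e => (mul_le_mul_of_nonneg_right (hbc i)
    (Finset.sum_nonneg fun i _ => mul_self_nonneg _)).trans (h i e)⟩

/-- A common quadratic upper bound for a finite family of matrices. -/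
lemma Matrix.exists_forall_dotProduct_mulVec_le {ι n : Type*} [Fintype ι] [Fintype n]
    (M : ι → Matrix n n ℝ) :
    ∃ c : ℝ, 0 < c ∧ ∀ i (e : n → ℝ), e ⬝ᵥ (M i *ᵥ e) ≤ c * (e ⬝ᵥ e) := by
  choose c hc h using fun i => (M i).exists_dotProduct_mulVec_le
  refine ⟨∑ i, c i + 1, add_pos_of_nonneg_of_pos
    (Finset.sum_nonneg fun i _ => (hc i).le) one_pos, fun i e => (h i e).trans ?_⟩
  refine mul_le_mul_of_nonneg_right ?_ (Finset.sum_nonneg fun i _ => mul_self_nonneg _)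
  linarith [Finset.single_le_sum (fun j _ => (hc j).le) (Finset.mem_univ i)]

lemma Matrix.dotProduct_sum_smul_mulVec {ι n : Type*} [Fintype ι] [Fintype n]
    (w : ι → ℝ) (M : ι → Matrix n n ℝ) (e : n → ℝ) :
    e ⬝ᵥ ((∑ i, w i • M i) *ᵥ e) = ∑ i, w i * (e ⬝ᵥ (M i *ᵥ e)) := by
  simp only [sum_mulVec, dotProduct_sum, smul_mulVec, dotProduct_smul, smul_eq_mul]

lemma Matrix.IsSymm.dotProduct_mulVec_comm {n : Type*} [Fintype n] {M : Matrix n n ℝ}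
    (hM : M.IsSymm) (x y : n → ℝ) : x ⬝ᵥ (M *ᵥ y) = y ⬝ᵥ (M *ᵥ x) := by
  rw [dotProduct_mulVec, ← mulVec_transpose, hM.eq, dotProduct_comm]

/-- Jensen's inequality for a positive semidefinite quadratic form. -/
lemma Matrix.PosSemidef.sum_smul_dotProduct_mulVec_le {ι n : Type*} [Fintype ι] [Fintype n]
    {M : Matrix n n ℝ} (hM : M.PosSemidef) {w : ι → ℝ} (hw : ∀ i, 0 ≤ w i)
    (hw1 : ∑ i, w i = 1) (y : ι → n → ℝ) :
    (∑ i, w i • y i) ⬝ᵥ (M *ᵥ (∑ i, w i • y i)) ≤ ∑ i, w i * (y i ⬝ᵥ (M *ᵥ y i)) := by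
  have hsymm : M.IsSymm := by simpa using hM.isHermitian
  set x := ∑ i, w i • y i with hx
  have hi : ∀ i, 2 * (y i ⬝ᵥ (M *ᵥ x)) - x ⬝ᵥ (M *ᵥ x) ≤ y i ⬝ᵥ (M *ᵥ y i) := fun i => by
    have h : 0 ≤ (y i - x) ⬝ᵥ (M *ᵥ (y i - x)) := by
      simpa using hM.dotProduct_mulVec_nonneg (y i - x)
    simp only [mulVec_sub, dotProduct_sub, sub_dotProduct] at h
    linarith [hsymm.dotProduct_mulVec_comm x (y i)]
  have hsum : ∑ i, w i * (y i ⬝ᵥ (M *ᵥ x)) = x ⬝ᵥ (M *ᵥ x) := by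
    conv_rhs => rw [hx, sum_dotProduct]
    simp only [smul_dotProduct, smul_eq_mul, ← hx]
  calc x ⬝ᵥ (M *ᵥ x)
      = ∑ i, w i * (2 * (y i ⬝ᵥ (M *ᵥ x)) - x ⬝ᵥ (M *ᵥ x)) := by
        simp only [mul_sub, Finset.sum_sub_distrib, ← Finset.sum_mul, hw1, mul_left_comm _ (2 : ℝ),
          ← Finset.mul_sum, hsum]
        ring
    _ ≤ ∑ i, w i * (y i ⬝ᵥ (M *ᵥ y i)) :=
        Finset.sum_le_sum fun i _ => mul_le_mul_of_nonneg_left (hi i) (hw i)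

/-- The vertex observer `-A(P + CᵀC)⁻¹Cᵀ` turns the detectability inequality
`P - AᵀQA + CᵀC ≻ 0` into a strict Lyapunov decrease of the error dynamics. -/
lemma posDef_sub_of_detectability {m n : Type*} [Fintype m] [Fintype n] [DecidableEq n]
    {A P Q : Matrix n n ℝ} {C : Matrix m n ℝ} (hP : P.PosDef) (hQ : Q.IsSymm)
    (h : (P - Aᵀ * Q * A + Cᵀ * C).PosDef) :
    (P - (A - A * (P + Cᵀ * C)⁻¹ * Cᵀ * C)ᵀ * Q *
      (A - A * (P + Cᵀ * C)⁻¹ * Cᵀ * C)).PosDef := by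
  have hPs : P.IsSymm := by simpa using hP.isHermitian
  set K := A - A * (P + Cᵀ * C)⁻¹ * Cᵀ * C with hK
  refine PosDef.of_dotProduct_mulVec_pos ?_ fun e he => ?_
  · simp [IsHermitian, Matrix.mul_assoc, hPs.eq, hQ.eq]
  have hS : (P + Cᵀ * C).PosDef :=
    hP.add_posSemidef (by simpa using posSemidef_conjTranspose_mul_self C)
  have hdet : IsUnit (P + Cᵀ * C).det := (isUnit_iff_isUnit_det _).1 hS.isUnit
  set S := P + Cᵀ * C with hSdef
  set v := S⁻¹ *ᵥ (P *ᵥ e) with hv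
  have hSv : S *ᵥ v = P *ᵥ e := by
    rw [hv, mulVec_mulVec, mul_nonsing_inv _ hdet, one_mulVec]
  have hKe : K *ᵥ e = A *ᵥ v := by
    have hKS : K = A * S⁻¹ * P := by
      have hPS : P = S - Cᵀ * C := by simp [hSdef]
      rw [hPS, Matrix.mul_sub, Matrix.mul_assoc A S⁻¹ S, nonsing_inv_mul _ hdet, hK,
        Matrix.mul_one, ← Matrix.mul_assoc]
    rw [hKS, hv, mulVec_mulVec, mulVec_mulVec]
  have hv0 : v ≠ 0 := by
    intro h0
    have hpos := hP.dotProduct_mulVec_pos he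
    rw [← hSv, h0] at hpos
    simp at hpos
  have hlmi := h.dotProduct_mulVec_pos hv0
  have hquad : ∀ (B : Matrix n n ℝ) (x : n → ℝ),
      x ⬝ᵥ ((Bᵀ * Q * B) *ᵥ x) = (B *ᵥ x) ⬝ᵥ (Q *ᵥ (B *ᵥ x)) := fun B x => by
    rw [Matrix.mul_assoc, ← mulVec_mulVec, ← mulVec_mulVec, dotProduct_mulVec,
      vecMul_transpose]
  have hCC : 0 ≤ v ⬝ᵥ ((Cᵀ * C) *ᵥ v) := by
    simpa using (posSemidef_conjTranspose_mul_self C).dotProduct_mulVec_nonneg v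
  have hw : 0 ≤ (e - v) ⬝ᵥ (P *ᵥ (e - v)) := by
    simpa using hP.posSemidef.dotProduct_mulVec_nonneg (e - v)
  have hvS : v ⬝ᵥ (P *ᵥ v) + v ⬝ᵥ ((Cᵀ * C) *ᵥ v) = v ⬝ᵥ (P *ᵥ e) := by
    rw [← hSv, hSdef, add_mulVec, dotProduct_add]
  simp only [star_trivial, sub_mulVec, add_mulVec, dotProduct_sub, dotProduct_add, hquad,
    hKe, mulVec_sub, sub_dotProduct] at hlmi hw ⊢
  linarith [hPs.dotProduct_mulVec_comm e v]

/-- Theorem 1 (sufficiency): if `P̄ᵢ - AᵢᵀP̄ⱼAᵢ + CᵀC ≻ 0` for all `i,j`, then the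
polytopic system is poly-quadratically detectable; moreover, the observer gain
`L(k,p) = -Σᵢ ξᵢ(p_k)Aᵢ(P̄ᵢ + CᵀC)⁻¹Cᵀ` renders the error system
poly-quadratically stable with poly-QLF `V(π,e) = eᵀP(π)e`. -/
theorem polyQ_detectability_sufficiency (nx ny np N : ℕ)
    (hnx : 0 < nx) (hny : 0 < ny) (hnp : 0 < np) (hN : 0 < N)
    (Pset : Set (Fin np → ℝ)) (hPc : IsCompact Pset)
    (ξ : Fin N → Pset → ℝ)
    (hξc : ∀ i, Continuous (ξ i))
    (hξ0 : ∀ i π, 0 ≤ ξ i π)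
    (hξ1 : ∀ π, ∑ i, ξ i π = 1)
    (A : Fin N → Matrix (Fin nx) (Fin nx) ℝ)
    (C : Matrix (Fin ny) (Fin nx) ℝ)
    (Pb : Fin N → Matrix (Fin nx) (Fin nx) ℝ)
    (hPb : ∀ i, (Pb i).PosDef)
    (hLMI : ∀ i j, (Pb i - (A i)ᵀ * Pb j * A i + Cᵀ * C).PosDef) :
    PolyQDetectable nx ny np N Pset ξ A C ∧
    RendersErrorPolyQS nx ny np N Pset ξ A C
      (fun k p => -(∑ i, ξ i (p k) • (A i * (Pb i + Cᵀ * C)⁻¹ * Cᵀ))) Pb := by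
  have hsymm : ∀ i, (Pb i).IsSymm := fun i => by simpa using (hPb i).isHermitian
  suffices h : RendersErrorPolyQS nx ny np N Pset ξ A C
      (fun k p => -(∑ i, ξ i (p k) • (A i * (Pb i + Cᵀ * C)⁻¹ * Cᵀ))) Pb from
    ⟨⟨_, Pb, hsymm, h⟩, h⟩
  set K : Fin N → Matrix (Fin nx) (Fin nx) ℝ :=
    fun i => A i - A i * (Pb i + Cᵀ * C)⁻¹ * Cᵀ * C with hK
  obtain ⟨a₁, ha₁, hlow⟩ := exists_pos_forall_mul_dotProduct_le hPb
  obtain ⟨a₂, ha₂, hupp⟩ := exists_forall_dotProduct_mulVec_le Pb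
  obtain ⟨a₃, ha₃, hdec⟩ := exists_pos_forall_mul_dotProduct_le
    (fun ij : Fin N × Fin N =>
      posDef_sub_of_detectability (hPb ij.1) (hsymm ij.2) (hLMI ij.1 ij.2))
  have hconst : ∀ (π : Pset) (c : ℝ), ∑ i, ξ i π * c = c := fun π c => by
    rw [← Finset.sum_mul, hξ1, one_mul]
  refine ⟨a₁, a₂, a₃, ha₁, ha₂, ha₃, fun π e => ?_, fun p k e => ?_⟩
  · rw [dotProduct_sum_smul_mulVec]
    constructor
    · rw [← hconst π (a₁ * _)]
      exact Finset.sum_le_sum fun i _ => mul_le_mul_of_nonneg_left (hlow i e) (hξ0 i π)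
    · rw [← hconst π (a₂ * _)]
      exact Finset.sum_le_sum fun i _ => mul_le_mul_of_nonneg_left (hupp i e) (hξ0 i π)
  have hclosed : ((∑ i, ξ i (p k) • A i) +
      -(∑ i, ξ i (p k) • (A i * (Pb i + Cᵀ * C)⁻¹ * Cᵀ)) * C) *ᵥ e
        = ∑ i, ξ i (p k) • (K i *ᵥ e) := by
    simp only [hK, Matrix.neg_mul, Matrix.sum_mul, Matrix.smul_mul,
      sum_mulVec, smul_mulVec, sub_mulVec, smul_sub, Finset.sum_sub_distrib, ← sub_eq_add_neg]
  have hvertex : ∀ i j, (K i *ᵥ e) ⬝ᵥ (Pb j *ᵥ (K i *ᵥ e))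
      ≤ e ⬝ᵥ (Pb i *ᵥ e) - a₃ * (e ⬝ᵥ e) := fun i j => by
    have h := hdec (i, j) e
    rw [sub_mulVec, dotProduct_sub, Matrix.mul_assoc, ← mulVec_mulVec, ← mulVec_mulVec,
      dotProduct_mulVec e (_ᵀ), vecMul_transpose] at h
    linarith
  simp only [hclosed, dotProduct_sum_smul_mulVec]
  rw [← hconst (p (k + 1)) (_ - _)]
  refine Finset.sum_le_sum fun j _ => mul_le_mul_of_nonneg_left ?_ (hξ0 j _)
  calc _ ≤ ∑ i, ξ i (p k) * ((K i *ᵥ e) ⬝ᵥ (Pb j *ᵥ (K i *ᵥ e))) :=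
        (hPb j).posSemidef.sum_smul_dotProduct_mulVec_le (fun i => hξ0 i _) (hξ1 _) _
    _ ≤ ∑ i, ξ i (p k) * (e ⬝ᵥ (Pb i *ᵥ e) - a₃ * (e ⬝ᵥ e)) :=
        Finset.sum_le_sum fun i _ => mul_le_mul_of_nonneg_left (hvertex i j) (hξ0 i _)
    _ = _ := by simp only [mul_sub, Finset.sum_sub_distrib, hconst]
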